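/- arXiv:1403.5500 — 2 statements merged into one kernel-verified Lean document; each statement's English description precedes it below -/
import Mathlib

section
/- Let G be a finite group and p a prime. Then the Euler characteristic of the realization of Quillen's complex A_p(G) satisfies χ(|A_p(G)|) = Σ_{n=0}^{rk_p(G)−1} (−1)^n p^{n(n+1)/2} · |A_p(G)_n|, where A_p(G)_n is the set of elementary abelian p-subgroups of G of rank n+1. -/
open scoped Classical

/-- A subgroup is elementary abelian for the prime `p` if it is abelian and every
element has order dividing `p`. -/
def IsElemAb {G : Type*} [Group G] (p : ℕ) (H : Subgroup G) : Prop :=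
  (∀ x ∈ H, x ^ p = 1) ∧ ∀ x ∈ H, ∀ y ∈ H, x * y = y * x

/-- The `p`-rank of a finite group `G`: the largest `n` such that `G` has an elementary
abelian `p`-subgroup of order `p ^ n`. -/
noncomputable def pRankGroup (G : Type*) [Group G] (p : ℕ) : ℕ :=
  sSup {n : ℕ | ∃ H : Subgroup G, IsElemAb p H ∧ Nat.card H = p ^ n}


/-- The Moebius value of an elementary abelian group of rank `r`. -/
def mobVal (p r : ℕ) : ℤ := (-1) ^ r * (p : ℤ) ^ (r * (r - 1) / 2)

theorem mobVal_succ (p r : ℕ) : mobVal p (r + 1) = - ((p : ℤ) ^ r * mobVal p r) := by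
  have h : (r + 1) * (r + 1 - 1) / 2 = r + r * (r - 1) / 2 := by
    cases r with
    | zero => rfl
    | succ s =>
      have : (s + 1 + 1) * (s + 1 + 1 - 1) = (s + 1) * (s + 1 - 1) + (s + 1) * 2 := by
        simp only [Nat.add_sub_cancel]; ring
      rw [this, Nat.add_mul_div_right _ _ (by norm_num)]
      ring
  unfold mobVal
  rw [h, pow_succ, pow_add]
  ring

section lin
variable {F V : Type*} [Field F] [Finite F] [AddCommGroup V] [Module F V] [Finite V]

set_option linter.unusedSectionVars false in
theorem card_compl (L : Submodule F V) (hL : Module.finrank F L = 1) (n : ℕ)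
    (hn : Module.finrank F V = n + 1) :
    Nat.card {q : Submodule F V // IsCompl L q} = Nat.card F ^ n := by
  obtain ⟨f0, hf0⟩ := LinearMap.exists_leftInverse_of_injective L.subtype (by simp)
  have hf0' : ∀ x : L, f0 x = x := fun x => by simpa using LinearMap.congr_fun hf0 x
  rw [Nat.card_congr (Submodule.isComplEquivProj L)]
  let T : (V →ₗ[F] L) →ₗ[F] (L →ₗ[F] L) := LinearMap.lcomp F L L.subtype
  have hT : ∀ f x, T f x = f x := fun f x => rfl
  have e : {f : V →ₗ[F] L // ∀ x : L, f x = x} ≃ LinearMap.ker T :=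
    { toFun := fun f => ⟨f.1 - f0, by
        rw [LinearMap.mem_ker]; ext x; simp [hT, hf0', f.2]⟩
      invFun := fun g => ⟨g.1 + f0, fun x => by
        have := LinearMap.congr_fun (LinearMap.mem_ker.1 g.2) x
        rw [hT] at this
        simp [this, hf0']⟩
      left_inv := fun f => by simp
      right_inv := fun g => by simp }
  rw [Nat.card_congr e, Module.natCard_eq_pow_finrank (K := F)]
  congr 1
  have h1 := LinearMap.finrank_range_add_finrank_ker T
  have h2 : LinearMap.range T = ⊤ := by
    rw [LinearMap.range_eq_top]
    intro g
    refine ⟨g ∘ₗ f0, ?_⟩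
    ext x
    simp [hT, hf0']
  rw [h2, finrank_top, Module.finrank_linearMap, Module.finrank_linearMap, hL, hn] at h1
  omega

theorem card_fiber (L M : Submodule F V) (hL : Module.finrank F L = 1) (hLM : L ≤ M) (n : ℕ)
    (hn : Module.finrank F M = n + 1) :
    Nat.card {W : Submodule F V // W ⊔ L = M ∧ Disjoint W L} = Nat.card F ^ n := by
  rw [← card_compl (L.comap M.subtype)
    (by rw [LinearEquiv.finrank_eq (Submodule.comapSubtypeEquivOfLe hLM), hL]) n hn]
  symm
  have key : ∀ q : Submodule F M, IsCompl (L.comap M.subtype) q ↔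
      (q.map M.subtype ⊔ L = M ∧ Disjoint (q.map M.subtype) L) := by
    intro q
    have hL' : L = (L.comap M.subtype).map M.subtype := by
      rw [Submodule.map_comap_subtype, inf_eq_right.2 hLM]
    have hinj := Submodule.map_injective_of_injective (f := M.subtype) M.injective_subtype
    rw [isCompl_comm, isCompl_iff, and_comm, codisjoint_iff, disjoint_iff, disjoint_iff]
    refine and_congr ?_ ?_
    · conv_rhs => rw [hL', ← Submodule.map_sup]
      rw [← hinj.eq_iff, Submodule.map_subtype_top]
    · conv_rhs => rw [hL', ← Submodule.map_inf _ M.injective_subtype]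
      rw [← hinj.eq_iff, Submodule.map_bot]
  refine Nat.card_eq_of_bijective
    (fun q => ⟨q.1.map M.subtype, (key q.1).1 q.2⟩) ⟨?_, ?_⟩
  · intro a b h
    exact Subtype.ext (Submodule.map_injective_of_injective M.injective_subtype
      (congrArg Subtype.val h))
  · rintro ⟨W, hW⟩
    have hWM : W ≤ M := hW.1 ▸ le_sup_left
    have h : (W.comap M.subtype).map M.subtype = W := by
      rw [Submodule.map_comap_subtype, inf_eq_right.2 hWM]
    refine ⟨⟨W.comap M.subtype, (key _).2 ?_⟩, Subtype.ext h⟩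
    rw [h]; exact hW

theorem sum_mob_lin [Nontrivial V] [Fintype (Submodule F V)] :
    ∑ W : Submodule F V, mobVal (Nat.card F) (Module.finrank F W) = 0 := by
  obtain ⟨v, hv⟩ := exists_ne (0 : V)
  set L := Submodule.span F {v} with hLdef
  have hL : Module.finrank F L = 1 := finrank_span_singleton hv
  have hatom : IsAtom L := nonzero_span_atom v hv
  rw [← Finset.sum_fiberwise Finset.univ (fun W => W ⊔ L)]
  refine Finset.sum_eq_zero fun M _ => ?_
  by_cases hLM : L ≤ M
  swap
  · apply Finset.sum_eq_zero
    intro W hW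
    simp only [Finset.mem_filter] at hW
    exact absurd (hW.2 ▸ le_sup_right) hLM
  obtain ⟨n, hn⟩ : ∃ n, Module.finrank F M = n + 1 := by
    have := Submodule.finrank_mono hLM
    exact ⟨Module.finrank F M - 1, by omega⟩
  have hsplit : (Finset.univ.filter fun W : Submodule F V => W ⊔ L = M) =
      insert M (Finset.univ.filter fun W : Submodule F V => W ⊔ L = M ∧ Disjoint W L) := by
    ext W
    simp only [Finset.mem_filter, Finset.mem_univ, true_and, Finset.mem_insert]
    constructor
    · intro h
      by_cases hd : Disjoint W L
      · exact Or.inr ⟨h, hd⟩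
      · left
        have : L ≤ W := by
          rcases hatom.le_iff.1 (inf_le_right : W ⊓ L ≤ L) with h' | h'
          · exact absurd (disjoint_iff.2 h') hd
          · exact inf_eq_right.1 h'
        rw [← h, sup_eq_left.2 this]
    · rintro (h | h)
      · rw [h, sup_eq_left.2 hLM]
      · exact h.1
  rw [hsplit, Finset.sum_insert]
  swap
  · simp only [Finset.mem_filter, not_and, Finset.mem_univ, true_and]
    intro _ h
    exact hatom.1 (by simpa [inf_eq_right.2 hLM] using h.eq_bot)
  rw [Finset.sum_congr rfl (g := fun _ => mobVal (Nat.card F) n), Finset.sum_const,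
    ← Fintype.card_subtype, ← Nat.card_eq_fintype_card, card_fiber L M hL hLM n hn, hn,
    mobVal_succ]
  · simp
  · intro W hW
    simp only [Finset.mem_filter, Finset.mem_univ, true_and] at hW
    have := Submodule.finrank_sup_add_finrank_inf_eq W L
    rw [hW.1, hW.2.eq_bot, hn, hL, finrank_bot] at this
    congr 1
    omega
end lin

theorem sum_mob_comm {A : Type*} [CommGroup A] [Finite A] [Nontrivial A] (p : ℕ)
    (hp : p.Prime) (h : ∀ x : A, x ^ p = 1) [Fintype (Subgroup A)] :
    ∑ K : Subgroup A, mobVal p (Nat.log p (Nat.card K)) = 0 := by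
  have : Fact p.Prime := ⟨hp⟩
  let : Module (ZMod p) (Additive A) := AddCommGroup.zmodModule (n := p) (fun x => h x.toMul)
  have : Finite (Submodule (ZMod p) (Additive A)) := inferInstance
  let : Fintype (Submodule (ZMod p) (Additive A)) := Fintype.ofFinite _
  rw [← sum_mob_lin (F := ZMod p) (V := Additive A)]
  let e := (Subgroup.toAddSubgroup (G := A)).trans (AddSubgroup.toZModSubmodule p)
  refine Fintype.sum_equiv e.toEquiv _ _ fun K => ?_
  have h1 : Nat.card K = Nat.card (e K) := rfl
  rw [h1, Module.natCard_eq_pow_finrank (K := ZMod p), Nat.card_zmod, Nat.log_pow hp.one_lt]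
  rfl

theorem sum_mob_le {G : Type*} [Group G] [Fintype G] (p : ℕ) (hp : p.Prime)
    (H : Subgroup G) (hH : IsElemAb p H) (hb : H ≠ ⊥) :
    ∑ K : Subgroup G with K ≤ H, mobVal p (Nat.log p (Nat.card K)) = 0 := by
  let : CommGroup H := { (inferInstance : Group H) with
    mul_comm := fun a b => Subtype.ext (hH.2 a a.2 b b.2) }
  have : Nontrivial H := (Subgroup.nontrivial_iff_ne_bot H).2 hb
  let : Fintype (Subgroup H) := Fintype.ofFinite _
  rw [← sum_mob_comm (A := H) p hp (fun x => Subtype.ext (hH.1 x x.2))]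
  symm
  refine Finset.sum_bij (fun K _ => K.map H.subtype) ?_ ?_ ?_ ?_
  · intro K _
    simpa using Subgroup.map_subtype_le K
  · intro a _ b _ h
    exact Subgroup.map_injective H.subtype_injective h
  · intro K hK
    simp only [Finset.mem_filter, Finset.mem_univ, true_and] at hK
    exact ⟨K.subgroupOf H, Finset.mem_univ _, by
      simpa using hK⟩
  · intro K _
    rw [Nat.card_congr (Subgroup.equivMapOfInjective K H.subtype H.subtype_injective).toEquiv]

section chains
variable {α : Type*} [PartialOrder α] [Fintype α]

/-- Number of chains `a₀ < ... < a_k = a` of elements satisfying `P`. -/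
noncomputable def chainTop (P : α → Prop) : ℕ → α → ℕ
  | 0, a => if P a then 1 else 0
  | k + 1, a => if P a then ∑ b : α with b < a, chainTop P k b else 0

theorem chainTop_card (P : α → Prop) (k : ℕ) (a : α) :
    Nat.card {f : Fin (k + 1) → α // (StrictMono f ∧ ∀ i, P (f i)) ∧ f (Fin.last k) = a} =
      chainTop P k a := by
  induction k generalizing a with
  | zero =>
    have : Subsingleton (Fin (0 + 1)) := inferInstanceAs (Subsingleton (Fin 1))
    unfold chainTop
    split_ifs with h
    · rw [Nat.card_eq_one_iff_unique]
      refine ⟨⟨fun f g => Subtype.ext (funext fun i => ?_)⟩,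
        ⟨⟨fun _ => a, ⟨Subsingleton.strictMono _, fun _ => h⟩, rfl⟩⟩⟩
      have hi : i = Fin.last 0 := Subsingleton.elim _ _
      rw [hi, f.2.2, g.2.2]
    · rw [Nat.card_eq_zero]
      exact Or.inl ⟨fun f => h (f.2.2 ▸ f.2.1.2 _)⟩
  | succ k ih =>
    rw [chainTop]
    split_ifs with h
    · simp_rw [← ih]
      have hext : ∀ x y : (Σ b : {b : α // b < a},
            {f : Fin (k + 1) → α // (StrictMono f ∧ ∀ i, P (f i)) ∧ f (Fin.last k) = b}),
          x.2.1 = y.2.1 → x = y := by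
        rintro ⟨⟨b, hb⟩, ⟨f, hf, hfb⟩⟩ ⟨⟨b', hb'⟩, ⟨f', hf', hfb'⟩⟩ hxy
        dsimp only at hfb hfb' hxy
        subst hxy hfb hfb'
        rfl
      have e : {f : Fin (k + 1 + 1) → α //
          (StrictMono f ∧ ∀ i, P (f i)) ∧ f (Fin.last (k + 1)) = a} ≃
          Σ b : {b : α // b < a},
            {f : Fin (k + 1) → α // (StrictMono f ∧ ∀ i, P (f i)) ∧ f (Fin.last k) = b} :=
        { toFun := fun f => ⟨⟨f.1 (Fin.last k).castSucc, by
              have h1 := f.2.1.1 (Fin.castSucc_lt_last (Fin.last k))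
              rw [f.2.2] at h1
              exact h1⟩,
            ⟨fun i => f.1 i.castSucc,
              ⟨fun i j hij => f.2.1.1 (Fin.castSucc_lt_castSucc_iff.2 hij), fun i => f.2.1.2 _⟩,
              rfl⟩⟩
          invFun := fun g => ⟨Fin.snoc (α := fun _ => α) g.2.1 a, ⟨by
              rw [Fin.strictMono_iff_lt_succ]
              intro i
              refine Fin.lastCases ?_ (fun j => ?_) i
              · rw [Fin.succ_last, Fin.snoc_last, Fin.snoc_castSucc, g.2.2.2]
                exact g.1.2
              · rw [Fin.succ_castSucc, Fin.snoc_castSucc, Fin.snoc_castSucc]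
                exact g.2.2.1.1 (Fin.castSucc_lt_succ), by
              intro i
              refine Fin.lastCases ?_ (fun j => ?_) i
              · rw [Fin.snoc_last]; exact h
              · rw [Fin.snoc_castSucc]; exact g.2.2.1.2 j⟩, by
              rw [Fin.snoc_last]⟩
          left_inv := by
            rintro ⟨f, hf, rfl⟩
            apply Subtype.ext
            exact Fin.snoc_init_self f
          right_inv := by
            intro g
            apply hext
            funext i
            exact Fin.snoc_castSucc (α := fun _ => α) a g.2.1 i }
      rw [Nat.card_congr e, Nat.card_sigma]
      rw [← Finset.sum_subtype_eq_sum_filter, Finset.subtype_univ]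
    · rw [Nat.card_eq_zero]
      exact Or.inl ⟨fun f => h (f.2.2 ▸ f.2.1.2 _)⟩

theorem chain_card (P : α → Prop) (k : ℕ) :
    Nat.card {f : Fin (k + 1) → α // StrictMono f ∧ ∀ i, P (f i)} = ∑ a, chainTop P k a := by
  simp_rw [← chainTop_card]
  rw [← Nat.card_sigma]
  refine Nat.card_congr
    { toFun := fun f => ⟨f.1 (Fin.last k), f.1, f.2, rfl⟩
      invFun := fun g => ⟨g.2.1, g.2.2.1⟩
      left_inv := fun f => rfl
      right_inv := ?_ }
  rintro ⟨b, ⟨f, hf, hfb⟩⟩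
  subst hfb
  rfl

/-- Truncated alternating sum of numbers of chains ending at `a`. -/
noncomputable def altTop (P : α → Prop) (N : ℕ) (a : α) : ℤ :=
  ∑ k ∈ Finset.range N, (-1 : ℤ) ^ k * chainTop P k a

theorem altTop_not (P : α → Prop) (N : ℕ) (a : α) (h : ¬ P a) : altTop P N a = 0 := by
  refine Finset.sum_eq_zero fun k _ => ?_
  cases k <;> simp [chainTop, h]

theorem altTop_succ (P : α → Prop) (N : ℕ) (a : α) (h : P a) :
    altTop P (N + 1) a = 1 - ∑ b : α with b < a, altTop P N b := by
  unfold altTop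
  rw [Finset.sum_range_succ', Finset.sum_comm]
  simp only [chainTop, h, if_true, pow_succ]
  push_cast
  simp only [Finset.mul_sum]
  rw [add_comm, sub_eq_add_neg, ← Finset.sum_neg_distrib]
  congr 1
  · simp
end chains

theorem IsElemAb.card {G : Type*} [Group G] [Fintype G] {p : ℕ} (hp : p.Prime)
    {H : Subgroup G} (hH : IsElemAb p H) : ∃ n, Nat.card H = p ^ n := by
  have : Fact p.Prime := ⟨hp⟩
  rw [← IsPGroup.iff_card]
  exact fun x => ⟨1, Subtype.ext (by simpa using hH.1 x x.2)⟩

theorem altTop_eq {G : Type*} [Group G] [Fintype G] (p : ℕ) (hp : p.Prime) (N : ℕ)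
    (H : Subgroup G) (hH : IsElemAb p H ∧ H ≠ ⊥) (hN : Nat.card H ≤ N) :
    altTop (fun K : Subgroup G => IsElemAb p K ∧ K ≠ ⊥) N H =
      - mobVal p (Nat.log p (Nat.card H)) := by
  induction N generalizing H with
  | zero => exact absurd hN (by have := Nat.card_pos (α := H); omega)
  | succ N ih =>
    rw [altTop_succ (fun K : Subgroup G => IsElemAb p K ∧ K ≠ ⊥) _ _ hH]
    have h0 := sum_mob_le p hp H hH.1 hH.2
    have hs : (Finset.univ.filter fun K : Subgroup G => K ≤ H) =
        insert H (Finset.univ.filter fun K : Subgroup G => K < H) := by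
      ext K
      simp [le_iff_eq_or_lt]
    rw [hs, Finset.sum_insert (by simp)] at h0
    have hbot : (⊥ : Subgroup G) ∈ (Finset.univ.filter fun K : Subgroup G => K < H) := by
      simpa using bot_lt_iff_ne_bot.2 hH.2
    rw [← Finset.add_sum_erase _ _ hbot] at h0 ⊢
    rw [altTop_not _ _ _ (by simp)]
    have h1 : mobVal p (Nat.log p (Nat.card (⊥ : Subgroup G))) = 1 := by
      simp [mobVal]
    rw [h1] at h0
    rw [Finset.sum_congr rfl
      (g := fun K : Subgroup G => - mobVal p (Nat.log p (Nat.card K))), Finset.sum_neg_distrib]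
    · linarith
    · intro K hK
      simp only [Finset.mem_erase, Finset.mem_filter, Finset.mem_univ, true_and] at hK
      refine ih K ⟨⟨fun x hx => hH.1.1 x (hK.2.le hx),
        fun x hx y hy => hH.1.2 x (hK.2.le hx) y (hK.2.le hy)⟩, hK.1⟩ ?_
      have : Nat.card K < Nat.card H := Set.ncard_lt_ncard (SetLike.coe_ssubset_coe.2 hK.2)
      omega

/-- For a finite group `G` and a prime `p`, the Euler characteristic of
(the realization of) Quillen's complex `A_p(G)` — computed via its order complex as the
alternating sum of the numbers of `k`-chains of nontrivial elementary abelian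
`p`-subgroups — equals `Σ_{n=0}^{rk_p(G)-1} (-1)^n p^{n(n+1)/2} |A_p(G)_n|`, where
`A_p(G)_n` is the set of elementary abelian `p`-subgroups of rank `n + 1`. -/
theorem euler_characteristic_quillen_complex
    (G : Type*) [Group G] [Fintype G] (p : ℕ) (hp : p.Prime) :
    ∑ k ∈ Finset.range (Fintype.card G + 1),
      (-1 : ℤ) ^ k *
        Nat.card {f : Fin (k + 1) → Subgroup G //
          StrictMono f ∧ ∀ i, IsElemAb p (f i) ∧ f i ≠ ⊥} =
    ∑ n ∈ Finset.range (pRankGroup G p),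
      (-1 : ℤ) ^ n * p ^ (n * (n + 1) / 2) *
        Nat.card {H : Subgroup G // IsElemAb p H ∧ Nat.card H = p ^ (n + 1)} := by
  simp_rw [chain_card (fun K : Subgroup G => IsElemAb p K ∧ K ≠ ⊥)]
  push_cast
  simp_rw [Finset.mul_sum]
  rw [Finset.sum_comm]
  have hstep : ∀ H : Subgroup G,
      (∑ k ∈ Finset.range (Fintype.card G + 1), (-1 : ℤ) ^ k *
        (chainTop (fun K : Subgroup G => IsElemAb p K ∧ K ≠ ⊥) k H : ℤ)) =
      ∑ n ∈ Finset.range (pRankGroup G p),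
        if IsElemAb p H ∧ Nat.card H = p ^ (n + 1) then
          (-1 : ℤ) ^ n * p ^ (n * (n + 1) / 2) else 0 := by
    intro H
    change altTop _ _ H = _
    by_cases hH : IsElemAb p H ∧ H ≠ ⊥
    · obtain ⟨r, hr⟩ := hH.1.card hp
      have hr0 : r ≠ 0 := by
        rintro rfl
        exact hH.2 (Subgroup.card_eq_one.1 (by simpa using hr))
      obtain ⟨n, rfl⟩ := Nat.exists_eq_succ_of_ne_zero hr0
      have hbdd : BddAbove {n : ℕ | ∃ H : Subgroup G, IsElemAb p H ∧ Nat.card H = p ^ n} := by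
        refine ⟨Nat.card G, ?_⟩
        rintro m ⟨K, _, hK⟩
        have h1 := Subgroup.card_le_card_group K
        have h2 := Nat.lt_pow_self hp.one_lt (n := m)
        omega
      have hn : n < pRankGroup G p := le_csSup hbdd ⟨H, hH.1, hr⟩
      rw [altTop_eq p hp _ H hH (by
        have h1 := Subgroup.card_le_card_group H
        rw [Nat.card_eq_fintype_card (α := G)] at h1
        omega), hr, Nat.log_pow hp.one_lt,
        Finset.sum_eq_single_of_mem n (Finset.mem_range.2 hn)]
      · rw [if_pos ⟨hH.1, rfl⟩, mobVal, Nat.succ_eq_add_one, Nat.add_sub_cancel, pow_succ,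
          mul_comm (n + 1) n]
        ring
      · intro m _ hm
        rw [if_neg]
        rintro ⟨_, h⟩
        have := Nat.pow_right_injective hp.two_le h
        omega
    · rw [altTop_not (fun K : Subgroup G => IsElemAb p K ∧ K ≠ ⊥) _ _ hH]
      symm
      refine Finset.sum_eq_zero fun n _ => if_neg ?_
      rintro ⟨h1, h2⟩
      refine hH ⟨h1, ?_⟩
      rintro rfl
      rw [Subgroup.card_bot] at h2
      exact absurd h2.symm (Nat.one_lt_pow (by omega) hp.one_lt).ne'
  rw [Finset.sum_congr rfl fun H _ => hstep H, Finset.sum_comm]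
  refine Finset.sum_congr rfl fun n _ => ?_
  rw [← Finset.sum_filter, Finset.sum_const, Nat.card_eq_fintype_card, Fintype.card_subtype,
    nsmul_eq_mul, mul_comm]
end

section
/- Let G be a finite group and p a prime. Then the Euler characteristic of the order complex of A_p(G), computed as the alternating sum over chains, Σ_{k≥0} (−1)^k · #{chains H_0 < H_1 < ... < H_k in A_p(G)}, equals Σ_{n=0}^{rk_p(G)−1} (−1)^n p^{n(n+1)/2} · #{H ≤ G : H elementary abelian of rank n+1}. -/
open scoped Classical

theorem chain_count {P : Type*} [PartialOrder P] [Fintype P] (k : ℕ) (x : P) :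
    (Nat.card {f : Fin (k + 1 + 1) → P // StrictMono f ∧ f (Fin.last _) = x} : ℤ) =
    ∑ y ∈ Finset.univ.filter (· < x), (Nat.card {f : Fin (k + 1) → P // StrictMono f ∧ f (Fin.last _) = y} : ℤ) := by
  have e : {f : Fin (k + 1 + 1) → P // StrictMono f ∧ f (Fin.last _) = x} ≃
     Σ y : {y // y < x}, {f : Fin (k + 1) → P // StrictMono f ∧ f (Fin.last _) = y.1} :=
   { toFun := fun f => ⟨⟨f.1 (Fin.last k).castSucc, by
        have := f.2.1 (Fin.castSucc_lt_last (Fin.last k))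
        rwa [f.2.2] at this⟩, ⟨fun i => f.1 i.castSucc, fun i j h => f.2.1 (by simpa using h), rfl⟩⟩
     invFun := fun s => ⟨Fin.snoc (α := fun _ => P) s.2.1 x, by
        refine ⟨?_, by simp⟩
        rw [Fin.strictMono_iff_lt_succ]
        intro i
        induction i using Fin.lastCases with
        | last => 
          rw [Fin.succ_last, Fin.snoc_last, Fin.snoc_castSucc, s.2.2.2]; exact s.1.2
        | cast i => 
          rw [← Fin.castSucc_succ, Fin.snoc_castSucc, Fin.snoc_castSucc]
          exact s.2.2.1 Fin.castSucc_lt_succ⟩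
     left_inv := by
        rintro ⟨f, hf, rfl⟩
        ext i
        induction i using Fin.lastCases <;> simp
     right_inv := by
        rintro ⟨⟨y, hy⟩, f, hf, h⟩
        dsimp at h
        subst h
        apply Sigma.subtype_ext
        · simp
        · funext i; simp }
  rw [Nat.card_congr e, Nat.card_sigma]
  push_cast
  rw [← Finset.sum_subtype_of_mem (p := (· < x)) (s := Finset.univ.filter (· < x))
    (fun y => (Nat.card {f : Fin (k + 1) → P // StrictMono f ∧ f (Fin.last _) = y} : ℤ)) (by simp)]
  apply Finset.sum_congr
  · ext y; simpa using y.2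
  · intros; rfl

theorem chain_total {P : Type*} [PartialOrder P] [Fintype P] (k : ℕ) :
    (Nat.card {f : Fin (k + 1) → P // StrictMono f} : ℤ) =
    ∑ y : P, (Nat.card {f : Fin (k + 1) → P // StrictMono f ∧ f (Fin.last _) = y} : ℤ) := by
  have e : {f : Fin (k + 1) → P // StrictMono f} ≃
     Σ y : P, {f : Fin (k + 1) → P // StrictMono f ∧ f (Fin.last _) = y} :=
   { toFun := fun f => ⟨f.1 (Fin.last k), f.1, f.2, rfl⟩
     invFun := fun s => ⟨s.2.1, s.2.2.1⟩
     left_inv := fun f => rfl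
     right_inv := by
        rintro ⟨y, f, hf, rfl⟩
        rfl }
  rw [Nat.card_congr e, Nat.card_sigma]
  push_cast
  rfl

theorem euler_poset {P : Type*} [PartialOrder P] [Fintype P] (N : ℕ)
    (hN : ∀ f : Fin (N + 1 + 1) → P, ¬ StrictMono f) (g : P → ℤ)
    (hg : ∀ x, ∑ y ∈ Finset.univ.filter (· ≤ x), g y = 1) :
    ∑ k ∈ Finset.range (N + 1), (-1 : ℤ) ^ k * Nat.card {f : Fin (k + 1) → P // StrictMono f} =
      ∑ x, g x := by
  simp_rw [chain_total, Finset.mul_sum]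
  rw [Finset.sum_comm]
  apply Finset.sum_congr rfl
  intro x _
  induction x using WellFoundedLT.induction with
  | ind x ih =>
  have h1 : g x = 1 - ∑ y ∈ Finset.univ.filter (· < x), g y := by
    rw [← hg x]
    have : (Finset.univ.filter (· ≤ x)) = insert x (Finset.univ.filter (· < x)) := by
      ext y; simp [le_iff_eq_or_lt]
    rw [this, Finset.sum_insert (by simp)]; ring
  rw [h1, ← Finset.sum_congr rfl (fun y hy => ih y (by simpa using hy) (Finset.mem_univ _)), Finset.sum_comm]
  simp_rw [← Finset.mul_sum, ← chain_count]
  rw [Finset.sum_range_succ', Finset.sum_range_succ _ N]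
  have h2 : Nat.card {f : Fin (N + 1 + 1) → P // StrictMono f ∧ f (Fin.last _) = x} = 0 := by
    have : IsEmpty {f : Fin (N + 1 + 1) → P // StrictMono f ∧ f (Fin.last _) = x} :=
      ⟨fun f => hN _ f.2.1⟩
    simp
  have h3 : Nat.card {f : Fin (0 + 1) → P // StrictMono f ∧ f (Fin.last _) = x} = 1 := by
    rw [Nat.card_eq_one_iff_unique]
    refine ⟨⟨fun a b => ?_⟩, ⟨fun _ => x, ?_, rfl⟩⟩
    · ext i
      have : i = Fin.last 0 := Fin.ext (by omega)
      rw [this, a.2.2, b.2.2]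
    · intro i j h; exact absurd (Fin.lt_def.mp h) (by omega)
  rw [h2, h3]
  simp only [pow_succ]
  simp [Finset.sum_neg_distrib]
  ring

universe u

/-- The weight `(-1)^r p^(r choose 2)` of an elementary abelian group of order `n = p^r`. -/
noncomputable def elemWeight (p n : ℕ) : ℤ := (-1) ^ (Nat.log p n) * p ^ ((Nat.log p n).choose 2)

theorem elemWeight_pow (p r : ℕ) (hp : p.Prime) :
    elemWeight p (p ^ r) = (-1) ^ r * p ^ (r.choose 2) := by
  simp [elemWeight, Nat.log_pow hp.one_lt]

theorem sum_subgroup_le {G : Type*} [Group G] [Finite G] [Fintype (Subgroup G)] (H : Subgroup G)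
    [Fintype (Subgroup H)]
    (F : ℕ → ℤ) :
    ∑ K : Subgroup H, F (Nat.card K) = ∑ K ∈ Finset.univ.filter (· ≤ H), F (Nat.card K) := by
  rw [Finset.sum_subtype (p := (· ≤ H)) _ (by simp)]
  apply Fintype.sum_equiv (Subgroup.MapSubtype.orderIso H).toEquiv
  intro K
  congr 1
  exact Nat.card_congr (K.equivMapOfInjective H.subtype H.subtype_injective).toEquiv

theorem sum_weight_eq_zero (p : ℕ) (hp : p.Prime) : ∀ (n : ℕ) (V : Type u) [CommGroup V] [Finite V]
    [Fintype (Subgroup V)],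
    Nat.card V = n → (∀ x : V, x ^ p = 1) → Nontrivial V →
    ∑ K : Subgroup V, elemWeight p (Nat.card K) = 0 := by
  intro n
  induction n using Nat.strong_induction_on with
  | _ n ih =>
  intro V _ _ _ hn hV _
  have : Fintype V := Fintype.ofFinite V
  have : Fact p.Prime := ⟨hp⟩
  obtain ⟨M, hM⟩ : ∃ M : Subgroup V, IsCoatom M := IsCoatomic.exists_coatom _
  have hsup : ∀ v, v ∉ M → M ⊔ Subgroup.zpowers v = ⊤ := by
    intro v hv
    refine hM.2 _ (lt_of_le_of_ne le_sup_left fun h => hv ?_)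
    rw [h]
    exact (le_sup_right : Subgroup.zpowers v ≤ _) (Subgroup.mem_zpowers v)
  have hord : ∀ v, v ∉ M → Nat.card (Subgroup.zpowers v) = p := by
    intro v hv
    rw [Nat.card_zpowers]
    exact orderOf_eq_prime (hV v) (fun h => hv (h ▸ M.one_mem))
  have hinf : ∀ v, v ∉ M → M ⊓ Subgroup.zpowers v = ⊥ := by
    intro v hv
    have hd := Subgroup.card_dvd_of_le (inf_le_right : M ⊓ Subgroup.zpowers v ≤ _)
    rw [hord v hv, Nat.dvd_prime hp] at hd
    rcases hd with h | h
    · exact Subgroup.card_eq_one.mp h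
    · exfalso
      have := Subgroup.eq_of_le_of_card_ge (inf_le_right : M ⊓ Subgroup.zpowers v ≤ _)
        (by rw [h, hord v hv])
      exact hv ((inf_eq_right.mp this) (Subgroup.mem_zpowers v))
  obtain ⟨v₀, hv₀⟩ : ∃ v, v ∉ M := by
    by_contra! h
    exact hM.1 (eq_top_iff.mpr fun v _ => h v)
  have hcard : Nat.card V = Nat.card M * p := by
    have hc : M.IsComplement' (Subgroup.zpowers v₀) := by
      apply Subgroup.isComplement'_of_disjoint_and_mul_eq_univ
      · rw [disjoint_iff, hinf _ hv₀]
      · rw [← Subgroup.mul_normal, hsup _ hv₀]; rfl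
    rw [← hc.card_mul_card, hord _ hv₀]
  have hidx : M.index = p := by
    have := M.card_mul_index
    rw [hcard] at this
    exact Nat.eq_of_mul_eq_mul_left Nat.card_pos this
  have hK : ∀ K : Subgroup V, ¬ K ≤ M → Nat.card K = Nat.card (K ⊓ M : Subgroup V) * p := by
    intro K hK
    have hd := Subgroup.relIndex_dvd_index_of_normal M K
    rw [hidx, Nat.dvd_prime hp] at hd
    rcases hd with h | h
    · exact absurd (Subgroup.relIndex_eq_one.mp h) hK
    · have := Subgroup.card_mul_index (M.subgroupOf K)
      rw [← this]
      congr 1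
      rw [← Subgroup.inf_subgroupOf_left]
      exact (Nat.card_congr (Subgroup.subgroupOfEquivOfLe inf_le_left).toEquiv)
  have hpow : ∀ K : Subgroup V, ∃ r, Nat.card K = p ^ r := by
    intro K
    rw [← IsPGroup.iff_card]
    intro x
    exact ⟨1, by ext; simpa using hV x⟩
  have hw : ∀ K : Subgroup V, ¬ K ≤ M → elemWeight p (Nat.card K) =
      - (Nat.card (K ⊓ M : Subgroup V) * elemWeight p (Nat.card (K ⊓ M : Subgroup V))) := by
    intro K hKM
    obtain ⟨r, hr⟩ := hpow (K ⊓ M)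
    rw [hK K hKM, hr, ← pow_succ, elemWeight_pow _ _ hp, elemWeight_pow _ _ hp,
      Nat.choose_succ_succ' r 1]
    push_cast
    simp
    ring
  have hdiff : ∀ K : Subgroup V, ¬ K ≤ M →
      ((Finset.univ.filter (fun v => v ∉ M ∧ v ∈ K)).card : ℤ) =
        (p - 1) * Nat.card (K ⊓ M : Subgroup V) := by
    intro K hKM
    have h1 : (Finset.univ.filter (fun v => v ∈ K)).card = Nat.card K := by
      rw [Nat.card_eq_fintype_card, Fintype.card_subtype]
    have h2 : (Finset.univ.filter (fun v => v ∈ K ∧ v ∈ M)).card = Nat.card (K ⊓ M : Subgroup V) := by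
      rw [Nat.card_eq_fintype_card, Fintype.card_subtype]
      simp [Subgroup.mem_inf]
    have h3 := Finset.card_filter_add_card_filter_not (s := Finset.univ.filter (fun v => v ∈ K)) (fun v => v ∈ M)
    rw [Finset.filter_filter, Finset.filter_filter, h1, h2, hK K hKM] at h3
    simp_rw [and_comm (a := _ ∉ M)]
    zify at h3
    linarith
  set S : ℤ := ∑ K ∈ Finset.univ.filter (· ≤ M), elemWeight p (Nat.card K) with hS
  have hbij : ∀ v, v ∉ M → ∑ K ∈ Finset.univ.filter (fun K => v ∈ K),
      elemWeight p (Nat.card (K ⊓ M : Subgroup V)) = S := by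
    intro v hv

    rw [hS]
    have hmem : ∀ K : Subgroup V, v ∈ K ↔ Subgroup.zpowers v ≤ K := fun K => Subgroup.zpowers_le.symm
    refine Finset.sum_bij' (fun K _ => K ⊓ M) (fun L _ => L ⊔ Subgroup.zpowers v) ?_ ?_ ?_ ?_ ?_
    · intro K _; simp
    · intro L _; rw [Finset.mem_filter, hmem]; exact ⟨Finset.mem_univ _, le_sup_right⟩
    · intro K h
      rw [Finset.mem_filter, hmem] at h
      rw [inf_sup_assoc_of_le _ h.2, hsup v hv, inf_top_eq]
    · intro L h
      rw [Finset.mem_filter] at h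
      rw [sup_inf_assoc_of_le _ h.2, inf_comm, hinf v hv, sup_bot_eq]
    · intros; rfl
  have hmain : (p - 1 : ℤ) * ∑ K ∈ Finset.univ.filter (fun K => ¬ K ≤ M), elemWeight p (Nat.card K) =
      - ((p - 1) * Nat.card M * S) := by
    have h1 : ∑ v ∈ Finset.univ.filter (fun v => v ∉ M), ∑ K ∈ Finset.univ.filter (fun K => v ∈ K),
      elemWeight p (Nat.card (K ⊓ M : Subgroup V)) = (p - 1) * Nat.card M * S := by
      rw [Finset.sum_congr rfl (fun v hv => hbij v (by simpa using hv)), Finset.sum_const, nsmul_eq_mul]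
      have := hdiff ⊤ (fun h => hM.1 (top_le_iff.mp h))
      simp at this
      rw [this]
      simp
    rw [← h1, Finset.sum_comm' (t' := Finset.univ.filter (fun K => ¬ K ≤ M))
      (s' := fun K => Finset.univ.filter (fun v => v ∉ M ∧ v ∈ K))]
    · rw [Finset.mul_sum, ← Finset.sum_neg_distrib]
      apply Finset.sum_congr rfl
      intro K hKM
      replace hKM : ¬ K ≤ M := by simpa using hKM
      rw [Finset.sum_const, nsmul_eq_mul, hdiff K hKM, hw K hKM]
      ring
    · intro v K
      simp only [Finset.mem_filter, Finset.mem_univ, true_and]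
      constructor
      · rintro ⟨h1, h2⟩; exact ⟨⟨h1, h2⟩, fun h => h1 (h h2)⟩
      · rintro ⟨h, _⟩; exact h
  have hp1 : (p - 1 : ℤ) ≠ 0 := by
    have := hp.one_lt
    omega
  have hfin : ∑ K ∈ Finset.univ.filter (fun K => ¬ K ≤ M), elemWeight p (Nat.card K) = - (Nat.card M * S) := by
    apply mul_left_cancel₀ hp1
    rw [hmain]; ring
  rw [← Finset.sum_filter_add_sum_filter_not _ (· ≤ M), hfin, ← hS]
  by_cases hMt : Nontrivial M
  · have : S = 0 := by
      have : Fintype (Subgroup M) := Fintype.ofFinite _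
      rw [hS, ← sum_subgroup_le]
      refine ih _ ?_ M rfl (fun x => by ext; simpa using hV x) hMt
      rw [← hn, hcard]
      have := hp.one_lt
      have := Nat.card_pos (α := M)
      nlinarith
    simp [this]
  · rw [not_nontrivial_iff_subsingleton] at hMt
    have : Nat.card M = 1 := Nat.card_eq_one_iff_unique.mpr ⟨hMt, inferInstance⟩
    rw [this]; simp

theorem elemAb_card {G : Type*} [Group G] [Finite G] (p : ℕ) (hp : p.Prime) (H : Subgroup G)
    (hH : IsElemAb p H) : ∃ r, Nat.card H = p ^ r := by
  have : Fact p.Prime := ⟨hp⟩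
  rw [← IsPGroup.iff_card]
  intro x
  exact ⟨1, by ext; simpa using hH.1 x x.2⟩

theorem sum_weight_le {G : Type u} [Group G] [Finite G] [Fintype (Subgroup G)] (p : ℕ) (hp : p.Prime)
    (H : Subgroup G) (hH : IsElemAb p H) (hb : H ≠ ⊥) :
    ∑ K ∈ Finset.univ.filter (· ≤ H), elemWeight p (Nat.card K) = 0 := by
  have : Fintype (Subgroup H) := Fintype.ofFinite _
  rw [← sum_subgroup_le]
  let _ : CommGroup H := { (inferInstance : Group H) with
    mul_comm := fun x y => Subtype.ext (hH.2 x x.2 y y.2) }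
  exact sum_weight_eq_zero p hp _ H rfl (fun x => by ext; simpa using hH.1 x x.2)
    ((Subgroup.nontrivial_iff_ne_bot H).mpr hb)

theorem rank_bound {G : Type*} [Group G] [Finite G] (p : ℕ) (hp : p.Prime) (H : Subgroup G)
    (hH : IsElemAb p H) (r : ℕ) (hr : Nat.card H = p ^ r) : r ≤ pRankGroup G p := by
  refine le_csSup ⟨Nat.card G, ?_⟩ ⟨H, hH, hr⟩
  rintro n ⟨K, _, hK⟩
  exact (Nat.lt_pow_self hp.one_lt).le.trans (hK ▸ K.card_le_card_group)

/-- For a finite group `G` and a prime `p`, the Euler characteristic of the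
order complex of `A_p(G)`, computed as the alternating sum
`Σ_{k ≥ 0} (-1)^k #{chains H_0 < ⋯ < H_k in A_p(G)}`, equals
`Σ_{n=0}^{rk_p(G)-1} (-1)^n p^{n(n+1)/2} #{H ≤ G elementary abelian of rank n+1}`. -/
theorem euler_characteristic_order_complex_quillen
    (G : Type*) [Group G] [Fintype G] (p : ℕ) (hp : p.Prime) :
    ∑ k ∈ Finset.range (Fintype.card G + 1),
      (-1 : ℤ) ^ k *
        Nat.card {f : Fin (k + 1) → Subgroup G //
          StrictMono f ∧ ∀ i, IsElemAb p (f i) ∧ f i ≠ ⊥} =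
    ∑ n ∈ Finset.range (pRankGroup G p),
      (-1 : ℤ) ^ n * p ^ (n * (n + 1) / 2) *
        Nat.card {H : Subgroup G // IsElemAb p H ∧ Nat.card H = p ^ (n + 1)} := by
  have _ : Fintype (Subgroup G) := Fintype.ofFinite _
  let P := {H : Subgroup G // IsElemAb p H ∧ H ≠ ⊥}
  have _ : Fintype P := Fintype.ofFinite _
  have hchain : ∀ k : ℕ, Nat.card {f : Fin (k + 1) → Subgroup G //
      StrictMono f ∧ ∀ i, IsElemAb p (f i) ∧ f i ≠ ⊥} =
      Nat.card {f : Fin (k + 1) → P // StrictMono f} := by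
    intro k
    exact Nat.card_congr
      { toFun := fun f => ⟨fun i => ⟨f.1 i, f.2.2 i⟩, fun i j h => f.2.1 h⟩
        invFun := fun f => ⟨fun i => (f.1 i).1, fun i j h => f.2 h, fun i => (f.1 i).2⟩
        left_inv := fun f => rfl
        right_inv := fun f => rfl }
  simp_rw [hchain]
  rw [euler_poset (P := P) (Fintype.card G) ?_ (fun H => - elemWeight p (Nat.card H.1)) ?_]
  · have hr : ∀ H : P, ∃ n, n < pRankGroup G p ∧ Nat.card H.1 = p ^ (n + 1) := by
      intro H
      obtain ⟨r, hr⟩ := elemAb_card p hp H.1 H.2.1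
      have hb := rank_bound p hp H.1 H.2.1 r hr
      rcases r with _ | n
      · exact absurd (Subgroup.card_eq_one.mp (by simpa using hr)) H.2.2
      · exact ⟨n, hb, hr⟩
    choose r hr1 hr2 using hr
    rw [← Finset.sum_fiberwise_of_maps_to (s := Finset.univ) (t := Finset.range (pRankGroup G p))
      (g := r) (fun H _ => Finset.mem_range.mpr (hr1 H))]
    apply Finset.sum_congr rfl
    intro n _
    have hval : ∀ H ∈ Finset.univ.filter (fun H : P => r H = n),
        - elemWeight p (Nat.card H.1) = (-1 : ℤ) ^ n * p ^ (n * (n + 1) / 2) := by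
      intro H hH
      have h : r H = n := by simpa using hH
      rw [hr2 H, h, elemWeight_pow _ _ hp, Nat.choose_two_right, Nat.add_sub_cancel,
        mul_comm (n + 1) n]
      ring
    rw [Finset.sum_congr rfl hval, Finset.sum_const, nsmul_eq_mul, mul_comm]
    congr 2
    have hne : ∀ H : {H : Subgroup G // IsElemAb p H ∧ Nat.card H = p ^ (n + 1)}, H.1 ≠ ⊥ := by
      intro H h
      have h2 := H.2.2
      rw [h, Subgroup.card_bot] at h2
      exact absurd h2 (Nat.one_lt_pow (Nat.succ_ne_zero n) hp.one_lt).ne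
    rw [← Fintype.card_subtype, ← Nat.card_eq_fintype_card]
    refine Nat.card_congr
      { toFun := fun H => ⟨H.1.1, H.1.2.1, by rw [hr2 H.1, H.2]⟩
        invFun := fun H => ⟨⟨H.1, H.2.1, hne H⟩, ?_⟩
        left_inv := fun f => rfl
        right_inv := fun f => rfl }
    · have h2 := (hr2 ⟨H.1, H.2.1, hne H⟩).symm.trans H.2.2
      exact Nat.succ_injective (Nat.pow_right_injective hp.two_le h2)
  · intro f hf
    have hm : StrictMono (fun i => Nat.card (f i).1) := by
      intro i j h
      have h1 : (f i).1 < (f j).1 := hf h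
      refine lt_of_le_of_ne (Subgroup.card_le_of_le h1.le) fun h2 => ?_
      exact h1.ne (Subgroup.eq_of_le_of_card_ge h1.le h2.ge)
    have h1 := Fintype.card_le_of_injective
      (fun i => (⟨Nat.card (f i).1, Nat.lt_succ_of_le (Subgroup.card_le_card_group _)⟩ :
        Fin (Nat.card G + 1)))
      (fun i j h => hm.injective (by simpa using h))
    simp at h1
  · rintro ⟨H, hH, hb⟩
    have h0 := sum_weight_le p hp H hH hb
    have h1 : (Finset.univ.filter (· ≤ H)) = insert ⊥ (Finset.univ.filter (fun K => K ≤ H ∧ K ≠ ⊥)) := by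
      ext K
      by_cases h : K = ⊥ <;> simp [h]
    rw [h1, Finset.sum_insert (by simp)] at h0
    have h2 : elemWeight p (Nat.card (⊥ : Subgroup G)) = 1 := by simp [elemWeight]
    rw [h2] at h0
    have h3 : ∑ K ∈ Finset.univ.filter (fun K => K ≤ H ∧ K ≠ ⊥), elemWeight p (Nat.card K) =
      ∑ K ∈ Finset.univ.filter (fun K : P => K ≤ ⟨H, hH, hb⟩), elemWeight p (Nat.card K.1) := by
      symm
      refine Finset.sum_bij (fun K _ => K.1) ?_ ?_ ?_ ?_
      · intro K hK
        have hK' : K ≤ ⟨H, hH, hb⟩ := by simpa using hK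
        simpa using ⟨hK', K.2.2⟩
      · intro K _ L _ h; exact Subtype.ext h
      · intro K hK
        have hK' : K ≤ H ∧ K ≠ ⊥ := by simpa using hK
        refine ⟨⟨K, ⟨fun x hx => hH.1 x (hK'.1 hx),
          fun x hx y hy => hH.2 x (hK'.1 hx) y (hK'.1 hy)⟩, hK'.2⟩, ?_, rfl⟩
        exact Finset.mem_filter.mpr ⟨Finset.mem_univ _, hK'.1⟩
      · intros; rfl
    rw [Finset.sum_neg_distrib, ← h3]
    linarith
end
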